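/- If a three-dimensional reflexive polytope Δ° admits a lattice point triangulation in which every three-dimensional simplex contains a fixed segment e between two boundary lattice points with the origin in its interior, then there exists a four-dimensional short top with reflexive boundary (Δ°)° whose polar dual has (0,0,0,-1) in the interior of an edge. -/

import Mathlib

open Finset Matrix Pointwise
open scoped Classical

noncomputable section

namespace SemistableTops

/-- A point of `ℝ^k` with all integer coordinates. -/
def IsLatticePt {k : ℕ} (x : Fin k → ℝ) : Prop := ∀ i, ∃ n : ℤ, x i = (n : ℝ)

/-- The lattice points lying in a subset of `ℝ^k`. -/
def latticePts {k : ℕ} (S : Set (Fin k → ℝ)) : Set (Fin k → ℝ) := {x ∈ S | IsLatticePt x}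

/-- The polar dual `{y : x ⬝ y ≥ -1 for all x ∈ S}`. -/
def polarDual {k : ℕ} (S : Set (Fin k → ℝ)) : Set (Fin k → ℝ) :=
  {y | ∀ x ∈ S, -1 ≤ ∑ i, x i * y i}

/-- A lattice polytope: the convex hull of finitely many lattice points. -/
def IsLatticePolytope {k : ℕ} (S : Set (Fin k → ℝ)) : Prop :=
  ∃ V : Finset (Fin k → ℝ), (∀ v ∈ V, IsLatticePt v) ∧ S = convexHull ℝ (V : Set (Fin k → ℝ))

/-- A reflexive polytope: a lattice polytope containing the origin whose polar dual is
again a lattice polytope. -/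
def IsReflexive {k : ℕ} (S : Set (Fin k → ℝ)) : Prop :=
  IsLatticePolytope S ∧ (0 : Fin k → ℝ) ∈ S ∧ IsLatticePolytope (polarDual S)

/-- `F` is a `d`-dimensional exposed face of `P`, cut out by a supporting hyperplane. -/
def IsFace {k : ℕ} (P F : Set (Fin k → ℝ)) (d : ℕ) : Prop :=
  ∃ (n : Fin k → ℝ) (c : ℝ), n ≠ 0 ∧ (∀ x ∈ P, c ≤ ∑ i, n i * x i) ∧
    F = {x ∈ P | ∑ i, n i * x i = c} ∧
    Module.finrank ℝ (affineSpan ℝ F).direction = d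

/-- Forget the last coordinate. -/
def projInit {k : ℕ} (x : Fin (k+1) → ℝ) : Fin k → ℝ := fun i => x i.castSucc

/-- The last coordinate. -/
def lastCoord {k : ℕ} (x : Fin (k+1) → ℝ) : ℝ := x (Fin.last k)

/-- The point `(0, …, 0, -1)`. -/
def negE (k : ℕ) : Fin (k+1) → ℝ := fun i => if i = Fin.last k then -1 else 0

/-- A `(k+1)`-dimensional top: a lattice polytope in the half-space `x_{k+1} ≥ 0`, whose
facet in the hyperplane `x_{k+1} = 0` is a `k`-dimensional reflexive polytope, and whose
other facets lie on hyperplanes `n ⬝ x = -1` with `n` a lattice point. -/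
structure IsTopPoly {k : ℕ} (Δ : Set (Fin (k+1) → ℝ)) : Prop where
  poly : IsLatticePolytope Δ
  halfspace : ∀ x ∈ Δ, 0 ≤ lastCoord x
  facets : ∃ N : Finset (Fin (k+1) → ℝ), (∀ n ∈ N, IsLatticePt n) ∧
      Δ = {x | 0 ≤ lastCoord x} ∩ ⋂ n ∈ N, {x | -1 ≤ ∑ i, n i * x i}
  reflexive_boundary : IsReflexive (projInit '' (Δ ∩ {x | lastCoord x = 0}))

/-- The summit of a top: its intersection with the half-space `x_{k+1} ≥ 1`. -/
def summit {k : ℕ} (Δ : Set (Fin (k+1) → ℝ)) : Set (Fin (k+1) → ℝ) :=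
  Δ ∩ {x | 1 ≤ lastCoord x}

/-- A short top: a top all of whose summit lattice points lie at height `1`. -/
def IsShortTop {k : ℕ} (Δ : Set (Fin (k+1) → ℝ)) : Prop :=
  IsTopPoly Δ ∧ ∀ x ∈ latticePts (summit Δ), lastCoord x = 1

/-- A lattice-preserving linear isomorphism of `ℝ^k` (an element of `GL_k(ℤ)`). -/
def UnimodularMap {k : ℕ} (φ : (Fin k → ℝ) → (Fin k → ℝ)) : Prop :=
  ∃ M : Matrix (Fin k) (Fin k) ℤ, IsUnit M.det ∧
    ∀ x, φ x = (M.map (fun z : ℤ => (z : ℝ))).mulVec x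

/-- The vertical ray `{t • e_{k+1} : t ≥ 0}`. -/
def upRay (n : ℕ) : Set (Fin (n+1) → ℝ) :=
  {x | ∃ t : ℝ, 0 ≤ t ∧ x = fun i => if i = Fin.last n then t else 0}

/-- A lattice point triangulation of a solid three-dimensional lattice polytope `P`:
3-simplices with vertices at lattice points of `P`, whose union is `P`, pairwise
intersecting in common faces. -/
def IsSolidLatticeTriangulation (P : Set (Fin 3 → ℝ))
    (𝒯 : Finset (Finset (Fin 3 → ℝ))) : Prop :=
  (∀ σ ∈ 𝒯, (↑σ : Set (Fin 3 → ℝ)) ⊆ latticePts P ∧ σ.card = 4 ∧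
      AffineIndependent ℝ (fun p : (σ : Set (Fin 3 → ℝ)) => (p : Fin 3 → ℝ))) ∧
  (⋃ σ ∈ 𝒯, convexHull ℝ (σ : Set (Fin 3 → ℝ))) = P ∧
  ∀ σ ∈ 𝒯, ∀ τ ∈ 𝒯, convexHull ℝ (σ : Set (Fin 3 → ℝ)) ∩ convexHull ℝ (τ : Set (Fin 3 → ℝ))
      = convexHull ℝ ((σ ∩ τ : Finset (Fin 3 → ℝ)) : Set (Fin 3 → ℝ))

/-! ### Linear functionals on finite convex hulls -/

lemma le_dotProduct_of_mem_convexHull {k : ℕ} {S : Set (Fin k → ℝ)} {y x : Fin k → ℝ} {c : ℝ}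
    (h : ∀ v ∈ S, c ≤ y ⬝ᵥ v) (hx : x ∈ convexHull ℝ S) : c ≤ y ⬝ᵥ x := by
  have hconv : Convex ℝ {x : Fin k → ℝ | c ≤ y ⬝ᵥ x} :=
    convex_halfSpace_ge ⟨fun a b => dotProduct_add y a b, fun r a => dotProduct_smul r y a⟩ c
  exact convexHull_min (fun v hv => h v hv) hconv hx

/-- A lower bound on the vertices of a face `l = c` is a lower bound on that face. -/
lemma le_dotProduct_of_mem_face {k : ℕ} {U : Finset (Fin k → ℝ)} {l m z : Fin k → ℝ} {c b : ℝ}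
    (hz : z ∈ convexHull ℝ (U : Set (Fin k → ℝ))) (hl : ∀ v ∈ U, c ≤ l ⬝ᵥ v) (hlz : l ⬝ᵥ z = c)
    (hm : ∀ v ∈ U, l ⬝ᵥ v = c → b ≤ m ⬝ᵥ v) : b ≤ m ⬝ᵥ z := by
  obtain ⟨w, hw0, hw1, rfl⟩ := Finset.mem_convexHull'.1 hz
  simp only [dotProduct_sum, dotProduct_smul, smul_eq_mul] at hlz ⊢
  have hsum : ∑ v ∈ U, w v * (l ⬝ᵥ v - c) = 0 := by
    simp only [mul_sub, Finset.sum_sub_distrib, hlz, ← Finset.sum_mul, hw1, one_mul, sub_self]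
  have hzero := (Finset.sum_eq_zero_iff_of_nonneg fun v hv =>
    mul_nonneg (hw0 v hv) (sub_nonneg.2 (hl v hv))).1 hsum
  calc b = ∑ v ∈ U, w v * b := by rw [← Finset.sum_mul, hw1, one_mul]
    _ ≤ ∑ v ∈ U, w v * (m ⬝ᵥ v) := by
      refine Finset.sum_le_sum fun v hv => ?_
      rcases mul_eq_zero.1 (hzero v hv) with h | h
      · simp [h]
      · exact mul_le_mul_of_nonneg_left (hm v hv (sub_eq_zero.1 h)) (hw0 v hv)

lemma exists_separating_dotProduct {k : ℕ} {U : Finset (Fin k → ℝ)} {x : Fin k → ℝ}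
    (hx : x ∉ convexHull ℝ (U : Set (Fin k → ℝ))) :
    ∃ y : Fin k → ℝ, ∀ v ∈ U, y ⬝ᵥ x < y ⬝ᵥ v := by
  obtain ⟨f, u, hfx, hf⟩ := geometric_hahn_banach_point_closed (convex_convexHull ℝ _)
    (U.finite_toSet.isClosed_convexHull ℝ) hx
  have key : ∀ z, f z = (fun i => f (Pi.single i 1)) ⬝ᵥ z := by
    intro z
    conv_lhs => rw [pi_eq_sum_univ' z]
    simp [dotProduct, mul_comm]
  refine ⟨fun i => f (Pi.single i 1), fun v hv => ?_⟩
  rw [← key, ← key]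
  exact hfx.trans (hf v (subset_convexHull ℝ _ hv))

/-! ### Polar duality for lattice polytopes containing the origin -/

lemma mem_polarDual {k : ℕ} {S : Set (Fin k → ℝ)} {y : Fin k → ℝ} :
    y ∈ polarDual S ↔ ∀ x ∈ S, -1 ≤ x ⬝ᵥ y := Iff.rfl

lemma mem_polarDual_convexHull {k : ℕ} {S : Set (Fin k → ℝ)} {y : Fin k → ℝ} :
    y ∈ polarDual (convexHull ℝ S) ↔ ∀ x ∈ S, -1 ≤ x ⬝ᵥ y := by
  refine ⟨fun h x hx => h x (subset_convexHull ℝ _ hx), fun h => mem_polarDual.2 fun x hx => ?_⟩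
  rw [dotProduct_comm]
  exact le_dotProduct_of_mem_convexHull (fun v hv => dotProduct_comm v y ▸ h v hv) hx

lemma polarDual_polarDual {k : ℕ} {U : Finset (Fin k → ℝ)}
    (h0 : (0 : Fin k → ℝ) ∈ convexHull ℝ (U : Set (Fin k → ℝ))) :
    polarDual (polarDual (convexHull ℝ (U : Set (Fin k → ℝ)))) = convexHull ℝ (U : Set _) := by
  refine Set.Subset.antisymm (fun x hx => ?_) fun x hx => mem_polarDual.2 fun y hy => ?_
  · by_contra hxU
    obtain ⟨y, hy⟩ := exists_separating_dotProduct hxU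
    have hU : U.Nonempty := by
      simpa using convexHull_nonempty_iff.1 ⟨_, h0⟩
    obtain ⟨v, hv, hmin⟩ := U.exists_min_image (fun v => y ⬝ᵥ v) hU
    have hv0 : y ⬝ᵥ v ≤ 0 := by
      simpa using le_dotProduct_of_mem_convexHull (S := U) (fun w hw => hmin w hw) h0
    have hlt := hy v hv
    set a := -(y ⬝ᵥ x + y ⬝ᵥ v) / 2 with ha
    have ha0 : 0 < a := by rw [ha]; linarith
    have hmem : a⁻¹ • y ∈ polarDual (convexHull ℝ (U : Set (Fin k → ℝ))) := by
      refine mem_polarDual_convexHull.2 fun w hw => ?_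
      have := hmin w hw
      rw [dotProduct_comm, smul_dotProduct, smul_eq_mul, inv_mul_eq_div, le_div_iff₀ ha0]
      linarith
    have := mem_polarDual.1 hx _ hmem
    rw [smul_dotProduct, smul_eq_mul, inv_mul_eq_div, le_div_iff₀ ha0] at this
    linarith
  · rw [dotProduct_comm]
    exact mem_polarDual.1 hy x hx

/-- The recession cone of a polytope is trivial. -/
lemma eq_zero_of_forall_nonneg {k : ℕ} {U W : Finset (Fin k → ℝ)}
    (hDW : ∀ x, x ∈ convexHull ℝ (U : Set (Fin k → ℝ)) ↔ ∀ n ∈ W, -1 ≤ n ⬝ᵥ x)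
    {w : Fin k → ℝ} (hw : ∀ n ∈ W, 0 ≤ n ⬝ᵥ w) : w = 0 := by
  by_contra hne
  have hpos : 0 < w ⬝ᵥ w :=
    lt_of_le_of_ne (Finset.sum_nonneg fun i _ => mul_self_nonneg _)
      fun h => hne (dotProduct_self_eq_zero.1 h.symm)
  obtain ⟨B, hB⟩ := (U.image fun v => -w ⬝ᵥ v).bddBelow
  have hB' : ∀ x ∈ convexHull ℝ (U : Set (Fin k → ℝ)), B ≤ -w ⬝ᵥ x := fun x hx =>
    le_dotProduct_of_mem_convexHull
      (fun v hv => hB (Finset.mem_coe.2 (Finset.mem_image_of_mem _ hv))) hx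
  have hray := hB' (((|B| + 1) / (w ⬝ᵥ w)) • w) ((hDW _).2 fun n hn => by
    have := mul_nonneg (by positivity : 0 ≤ (|B| + 1) / (w ⬝ᵥ w)) (hw n hn)
    rw [dotProduct_smul, smul_eq_mul]
    linarith)
  rw [dotProduct_smul, smul_eq_mul, neg_dotProduct, mul_neg, div_mul_cancel₀ _ hpos.ne'] at hray
  linarith [neg_abs_le B]

lemma exists_dotProduct_eq_neg_one_of_mem_frontier {k : ℕ} {D : Set (Fin k → ℝ)}
    {W : Finset (Fin k → ℝ)} (hDW : ∀ x, x ∈ D ↔ ∀ n ∈ W, -1 ≤ n ⬝ᵥ x) {p : Fin k → ℝ}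
    (hpD : p ∈ D) (hp : p ∈ frontier D) : ∃ n ∈ W, n ⬝ᵥ p = -1 := by
  by_contra! hne
  have hopen : IsOpen {x : Fin k → ℝ | ∀ n ∈ W, -1 < n ⬝ᵥ x} := by
    simp only [Set.ofPred_forall]
    exact isOpen_biInter_finset fun n _ =>
      isOpen_lt continuous_const (continuous_const.dotProduct continuous_id)
  exact hp.2 (interior_maximal (fun x hx => (hDW x).2 fun n hn => (hx n hn).le) hopen
    fun n hn => lt_of_le_of_ne ((hDW p).1 hpD n hn) (hne n hn).symm)

lemma IsLatticePt.dotProduct {k : ℕ} {x y : Fin k → ℝ} (hx : IsLatticePt x)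
    (hy : IsLatticePt y) : ∃ a : ℤ, x ⬝ᵥ y = a := by
  choose f hf using hx
  choose g hg using hy
  exact ⟨∑ i, f i * g i, by simp [_root_.dotProduct, hf, hg]⟩

lemma IsLatticePt.add {k : ℕ} {x y : Fin k → ℝ} (hx : IsLatticePt x) (hy : IsLatticePt y) :
    IsLatticePt (x + y) := fun i => by
  obtain ⟨a, ha⟩ := hx i
  obtain ⟨b, hb⟩ := hy i
  exact ⟨a + b, by simp [ha, hb]⟩

lemma IsLatticePt.neg {k : ℕ} {x : Fin k → ℝ} (hx : IsLatticePt x) : IsLatticePt (-x) := fun i => by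
  obtain ⟨a, ha⟩ := hx i
  exact ⟨-a, by simp [ha]⟩

/-- Two boundary lattice points of a reflexive polytope with the origin strictly between them
are opposite. -/
lemma eq_neg_of_zero_mem_openSegment {k : ℕ} {D : Set (Fin k → ℝ)} {W : Finset (Fin k → ℝ)}
    (hDW : ∀ x, x ∈ D ↔ ∀ n ∈ W, -1 ≤ n ⬝ᵥ x) (hW : ∀ n ∈ W, IsLatticePt n) {p q : Fin k → ℝ}
    (hpD : p ∈ D) (hqD : q ∈ D) (hp : p ∈ latticePts (frontier D))
    (hq : q ∈ latticePts (frontier D)) (h0 : (0 : Fin k → ℝ) ∈ openSegment ℝ p q) : q = -p := by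
  obtain ⟨a, b, ha, hb, -, hab⟩ := h0
  obtain ⟨n, hn, hnp⟩ := exists_dotProduct_eq_neg_one_of_mem_frontier hDW hpD hp.1
  obtain ⟨n', hn', hnq⟩ := exists_dotProduct_eq_neg_one_of_mem_frontier hDW hqD hq.1
  obtain ⟨i, hi⟩ := (hW n hn).dotProduct hq.2
  obtain ⟨j, hj⟩ := (hW n' hn').dotProduct hp.2
  have e1 : a * (n ⬝ᵥ p) + b * (n ⬝ᵥ q) = 0 := by
    rw [← smul_eq_mul, ← smul_eq_mul, ← dotProduct_smul, ← dotProduct_smul, ← dotProduct_add, hab,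
      dotProduct_zero]
  have e2 : a * (n' ⬝ᵥ p) + b * (n' ⬝ᵥ q) = 0 := by
    rw [← smul_eq_mul, ← smul_eq_mul, ← dotProduct_smul, ← dotProduct_smul, ← dotProduct_add, hab,
      dotProduct_zero]
  rw [hnp, hi] at e1
  rw [hnq, hj] at e2
  have hi0 : 0 < i := by
    have : (0 : ℝ) < i := pos_of_mul_pos_right (by linarith : 0 < b * (i : ℝ)) hb.le
    exact_mod_cast this
  have hj0 : 0 < j := by
    have : (0 : ℝ) < j := pos_of_mul_pos_right (by linarith : 0 < a * (j : ℝ)) ha.le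
    exact_mod_cast this
  have hi1 : (1 : ℝ) ≤ i := by exact_mod_cast hi0
  have hj1 : (1 : ℝ) ≤ j := by exact_mod_cast hj0
  have heq : a = b := le_antisymm (by nlinarith) (by nlinarith)
  subst heq
  rw [← smul_add] at hab
  exact (neg_eq_of_add_eq_zero_right ((smul_eq_zero.1 hab).resolve_left ha.ne')).symm

/-! ### Points of `ℝ^(k+1)` at a given height -/

/-- The point of `ℝ^(k+1)` over `x` with last coordinate `c`. -/
def liftAt {k : ℕ} (x : Fin k → ℝ) (c : ℝ) : Fin (k + 1) → ℝ := Fin.snoc (α := fun _ => ℝ) x c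

@[simp] lemma projInit_liftAt {k : ℕ} (x : Fin k → ℝ) (c : ℝ) : projInit (liftAt x c) = x := by
  ext i
  simp [projInit, liftAt]

@[simp] lemma lastCoord_liftAt {k : ℕ} (x : Fin k → ℝ) (c : ℝ) : lastCoord (liftAt x c) = c := by
  simp [lastCoord, liftAt]

@[simp] lemma liftAt_projInit_lastCoord {k : ℕ} (z : Fin (k + 1) → ℝ) :
    liftAt (projInit z) (lastCoord z) = z :=
  Fin.snoc_init_self (α := fun _ => ℝ) z

lemma dotProduct_eq_projInit_add {k : ℕ} (x y : Fin (k + 1) → ℝ) :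
    x ⬝ᵥ y = projInit x ⬝ᵥ projInit y + lastCoord x * lastCoord y :=
  Fin.sum_univ_castSucc _

@[simp] lemma liftAt_dotProduct {k : ℕ} (x : Fin k → ℝ) (c : ℝ) (y : Fin (k + 1) → ℝ) :
    liftAt x c ⬝ᵥ y = x ⬝ᵥ projInit y + c * lastCoord y := by
  rw [dotProduct_eq_projInit_add, projInit_liftAt, lastCoord_liftAt]

lemma IsLatticePt.liftAt {k : ℕ} {x : Fin k → ℝ} {c : ℝ} (hx : IsLatticePt x)
    (hc : ∃ n : ℤ, c = n) : IsLatticePt (liftAt x c) := by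
  intro i
  refine Fin.lastCases ?_ (fun i => ?_) i
  · simpa [SemistableTops.liftAt] using hc
  · simpa [SemistableTops.liftAt] using hx i

/-! ### Fibring a reflexive polytope along a pair of opposite boundary points -/

/-- A reflexive polytope with vertices among `U`, whose polar dual has vertices among `W`,
such that `p` and `-p` are boundary lattice points. -/
structure IsOppositePair {k : ℕ} (U W : Finset (Fin k → ℝ)) (p : Fin k → ℝ) : Prop where
  lattice_left : ∀ v ∈ U, IsLatticePt v
  lattice_right : ∀ n ∈ W, IsLatticePt n
  lattice_point : IsLatticePt p
  zero_mem : (0 : Fin k → ℝ) ∈ convexHull ℝ (W : Set (Fin k → ℝ))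
  mem_iff : ∀ x, x ∈ convexHull ℝ (U : Set (Fin k → ℝ)) ↔ ∀ n ∈ W, -1 ≤ n ⬝ᵥ x
  height : ∀ n ∈ W, n ⬝ᵥ p = -1 ∨ n ⬝ᵥ p = 0 ∨ n ⬝ᵥ p = 1

/-- Lattice points spanning twice the slice by `p^⊥` of the polytope spanned by `W`. -/
def slicePts {k : ℕ} (W : Finset (Fin k → ℝ)) (p : Fin k → ℝ) : Finset (Fin k → ℝ) :=
  insert 0 (({n ∈ W | n ⬝ᵥ p = 0}.image fun n => n + n) ∪
    ({n ∈ W | n ⬝ᵥ p = 1} + {n ∈ W | n ⬝ᵥ p = -1}))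

lemma mem_slicePts {k : ℕ} {W : Finset (Fin k → ℝ)} {p l : Fin k → ℝ} (hl : l ∈ slicePts W p) :
    l = 0 ∨ ∃ a ∈ W, ∃ b ∈ W, a ⬝ᵥ p + b ⬝ᵥ p = 0 ∧ l = a + b := by
  simp only [slicePts, Finset.mem_insert, Finset.mem_union, Finset.mem_image, Finset.mem_filter,
    Finset.mem_add] at hl
  rcases hl with rfl | ⟨a, ⟨ha, hap⟩, rfl⟩ | ⟨a, ⟨ha, hap⟩, b, ⟨hb, hbp⟩, rfl⟩
  · exact Or.inl rfl
  · exact Or.inr ⟨a, ha, a, ha, by simp [hap], rfl⟩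
  · exact Or.inr ⟨a, ha, b, hb, by simp [hap, hbp], rfl⟩

lemma zero_mem_slicePts {k : ℕ} (W : Finset (Fin k → ℝ)) (p : Fin k → ℝ) : 0 ∈ slicePts W p :=
  Finset.mem_insert_self _ _

lemma dotProduct_eq_zero_of_mem_slicePts {k : ℕ} {W : Finset (Fin k → ℝ)} {p l : Fin k → ℝ}
    (hl : l ∈ slicePts W p) : l ⬝ᵥ p = 0 := by
  rcases mem_slicePts hl with rfl | ⟨a, -, b, -, h, rfl⟩
  · exact zero_dotProduct p
  · rw [add_dotProduct, h]

lemma neg_two_le_dotProduct_of_mem_slicePts {k : ℕ} {W : Finset (Fin k → ℝ)} {p l y : Fin k → ℝ}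
    (hl : l ∈ slicePts W p) (hy : ∀ n ∈ W, -1 ≤ n ⬝ᵥ y) : -2 ≤ l ⬝ᵥ y := by
  rcases mem_slicePts hl with rfl | ⟨a, ha, b, hb, -, rfl⟩
  · rw [zero_dotProduct]; norm_num
  · rw [add_dotProduct]; linarith [hy a ha, hy b hb]

/-- The points of `U` at which the slice of the dual attains the bound `-1`. -/
def rimPts {k : ℕ} (U W : Finset (Fin k → ℝ)) (p : Fin k → ℝ) : Finset (Fin k → ℝ) :=
  {v ∈ U | ∃ l ∈ slicePts W p, l ⬝ᵥ v = -2}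

/-- The lattice normals of the top: the points `(±p, -1)` and `(v, 1)` for rim points `v`. -/
def topNormals {k : ℕ} (U W : Finset (Fin k → ℝ)) (p : Fin k → ℝ) : Finset (Fin (k + 1) → ℝ) :=
  {liftAt p (-1), liftAt (-p) (-1)} ∪ (rimPts U W p).image fun v => liftAt v 1

/-- The vertices of the top: `W` at height `0`, and the doubled slice at height `1`. -/
def topVertices {k : ℕ} (W : Finset (Fin k → ℝ)) (p : Fin k → ℝ) : Finset (Fin (k + 1) → ℝ) :=
  (W.image fun n => liftAt n 0) ∪ (slicePts W p).image fun l => liftAt l 1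

namespace IsOppositePair

variable {k : ℕ} {U W : Finset (Fin k → ℝ)} {p : Fin k → ℝ}

/-- Every point of the polytope splits as a multiple of `p` and a multiple of a rim point. -/
lemma exists_splitting (h : IsOppositePair U W p) {y : Fin k → ℝ} (hy : ∀ n ∈ W, -1 ≤ n ⬝ᵥ y) :
    ∃ (γ σ : ℝ) (w : Fin k → ℝ), 0 ≤ γ ∧ |σ| ≤ 1 - γ ∧ y = w + σ • p ∧
      (∀ n ∈ W, -γ ≤ n ⬝ᵥ w) ∧ ∃ l ∈ slicePts W p, l ⬝ᵥ y = -2 * γ := by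
  obtain ⟨l, hl, hmin⟩ := (slicePts W p).exists_min_image (fun l => l ⬝ᵥ y)
    ⟨0, zero_mem_slicePts W p⟩
  obtain ⟨γ, hγ⟩ : ∃ γ, l ⬝ᵥ y = -2 * γ := ⟨-(l ⬝ᵥ y) / 2, by ring⟩
  simp only [hγ] at hmin
  have hγ0 : 0 ≤ γ := by
    have := hmin 0 (zero_mem_slicePts W p)
    rw [zero_dotProduct] at this
    linarith
  have hγ1 : γ ≤ 1 := by linarith [neg_two_le_dotProduct_of_mem_slicePts hl hy]
  obtain ⟨σ, hσ, hσmax⟩ := (insert (γ - 1) ({n ∈ W | n ⬝ᵥ p = -1}.image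
    fun n => -γ - n ⬝ᵥ y)).exists_max_image id ⟨_, Finset.mem_insert_self _ _⟩
  simp only [Finset.mem_insert, Finset.mem_image, Finset.mem_filter, id, forall_eq_or_imp,
    forall_exists_index, and_imp] at hσ hσmax
  have hσ1 : σ ≤ 1 - γ := by
    rcases hσ with rfl | ⟨n, ⟨hn, -⟩, rfl⟩
    · linarith
    · linarith [hy n hn]
  refine ⟨γ, σ, y - σ • p, hγ0, abs_le.2 ⟨by linarith [hσmax.1], hσ1⟩, by simp, fun n hn => ?_,
    l, hl, hγ⟩
  rw [dotProduct_sub, dotProduct_smul, smul_eq_mul]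
  rcases h.height n hn with hnp | hnp | hnp <;> rw [hnp]
  · linarith [hσmax.2 _ n hn hnp rfl]
  · have := hmin (n + n) (Finset.mem_insert_of_mem (Finset.mem_union_left _
      (Finset.mem_image_of_mem _ (Finset.mem_filter.2 ⟨hn, hnp⟩))))
    rw [add_dotProduct] at this
    linarith
  · rcases hσ with rfl | ⟨n', ⟨hn', hnp'⟩, rfl⟩
    · linarith [hy n hn]
    · have := hmin (n + n') (Finset.mem_insert_of_mem (Finset.mem_union_right _
        (Finset.add_mem_add (Finset.mem_filter.2 ⟨hn, hnp⟩) (Finset.mem_filter.2 ⟨hn', hnp'⟩))))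
      rw [add_dotProduct] at this
      linarith

/-- The splitting, with the rim part tested against functionals bounded below on rim points. -/
lemma exists_splitting_bound (h : IsOppositePair U W p) {y : Fin k → ℝ}
    (hy : ∀ n ∈ W, -1 ≤ n ⬝ᵥ y) :
    ∃ (γ σ : ℝ) (w : Fin k → ℝ), 0 ≤ γ ∧ |σ| ≤ 1 - γ ∧ y = w + σ • p ∧ (γ = 0 → w = 0) ∧
      (∀ (m : Fin k → ℝ) (b : ℝ), (∀ v ∈ rimPts U W p, b ≤ m ⬝ᵥ v) → γ * b ≤ m ⬝ᵥ w) ∧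
      ∃ l ∈ slicePts W p, l ⬝ᵥ y = -2 * γ := by
  obtain ⟨γ, σ, w, hγ0, hσ, rfl, hw, l, hl, hly⟩ := h.exists_splitting hy
  have hw0 : γ = 0 → w = 0 := fun hγ =>
    eq_zero_of_forall_nonneg h.mem_iff fun n hn => by simpa [hγ] using hw n hn
  refine ⟨γ, σ, w, hγ0, hσ, rfl, hw0, fun m b hm => ?_, l, hl, hly⟩
  rcases hγ0.eq_or_lt with hγ | hγ
  · simp [← hγ, hw0 hγ.symm]
  have hzW : ∀ n ∈ W, -1 ≤ n ⬝ᵥ (γ⁻¹ • w) := fun n hn => by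
    rw [dotProduct_smul, smul_eq_mul, inv_mul_eq_div, le_div_iff₀ hγ]
    linarith [hw n hn]
  have hlw : l ⬝ᵥ (γ⁻¹ • w) = -2 := by
    rw [dotProduct_add, dotProduct_smul, dotProduct_eq_zero_of_mem_slicePts hl, smul_zero,
      add_zero] at hly
    rw [dotProduct_smul, hly, smul_eq_mul]
    field_simp
  have hz := le_dotProduct_of_mem_face ((h.mem_iff _).2 hzW)
    (fun v hv => neg_two_le_dotProduct_of_mem_slicePts hl
      ((h.mem_iff v).1 (subset_convexHull ℝ _ hv))) hlw
    (fun v hv hlv => hm v (Finset.mem_filter.2 ⟨hv, l, hl, hlv⟩))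
  rwa [dotProduct_smul, smul_eq_mul, inv_mul_eq_div, le_div_iff₀ hγ, mul_comm] at hz

lemma forall_topNormals_iff {x : Fin (k + 1) → ℝ} :
    (∀ n ∈ topNormals U W p, -1 ≤ n ⬝ᵥ x) ↔ |projInit x ⬝ᵥ p| ≤ 1 - lastCoord x ∧
      ∀ v ∈ rimPts U W p, -1 - lastCoord x ≤ projInit x ⬝ᵥ v := by
  simp only [topNormals, Finset.mem_union, Finset.mem_insert, Finset.mem_singleton,
    Finset.mem_image, or_imp, forall_and, forall_eq, forall_exists_index, and_imp,
    forall_apply_eq_imp_iff₂, liftAt_dotProduct, neg_dotProduct, abs_le]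
  refine and_congr ?_ (forall₂_congr fun v _ => ?_)
  · rw [dotProduct_comm p]
    constructor <;> rintro ⟨h1, h2⟩ <;> constructor <;> linarith
  · rw [dotProduct_comm v]
    constructor <;> intro <;> linarith

lemma forall_topVertices_iff {y : Fin (k + 1) → ℝ} :
    (∀ v ∈ topVertices W p, -1 ≤ v ⬝ᵥ y) ↔ (∀ n ∈ W, -1 ≤ n ⬝ᵥ projInit y) ∧
      ∀ l ∈ slicePts W p, -1 - lastCoord y ≤ l ⬝ᵥ projInit y := by
  simp only [topVertices, Finset.mem_union, Finset.mem_image, or_imp, forall_and,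
    forall_exists_index, and_imp, forall_apply_eq_imp_iff₂, liftAt_dotProduct, zero_mul, add_zero,
    one_mul, sub_le_iff_le_add]

lemma abs_dotProduct_le_one (h : IsOppositePair U W p) {n : Fin k → ℝ} (hn : n ∈ W) :
    |n ⬝ᵥ p| ≤ 1 := by
  rcases h.height n hn with e | e | e <;> simp [e]

lemma neg_one_le_dotProduct_rimPts (h : IsOppositePair U W p) {v n : Fin k → ℝ}
    (hv : v ∈ rimPts U W p) (hn : n ∈ W) : -1 ≤ n ⬝ᵥ v :=
  (h.mem_iff v).1 (subset_convexHull ℝ _ (Finset.mem_filter.1 hv).1) n hn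

lemma convexHull_topVertices (h : IsOppositePair U W p) :
    convexHull ℝ (topVertices W p : Set (Fin (k + 1) → ℝ)) =
      {x | 0 ≤ lastCoord x} ∩ ⋂ n ∈ topNormals U W p, {x | -1 ≤ ∑ i, n i * x i} := by
  have hmem : ∀ x, x ∈ ⋂ n ∈ topNormals U W p, {x : Fin (k + 1) → ℝ | -1 ≤ ∑ i, n i * x i} ↔
      ∀ n ∈ topNormals U W p, -1 ≤ n ⬝ᵥ x := fun x => by
    simp only [Set.mem_iInter, Set.mem_ofPred_eq]; rfl
  refine Set.Subset.antisymm (fun x hx => ?_) ?_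
  · have hlast : lastCoord x = liftAt 0 1 ⬝ᵥ x := by simp
    refine ⟨?_, (hmem x).2 fun n hn => le_dotProduct_of_mem_convexHull (fun v hv => ?_) hx⟩
    · rw [Set.mem_ofPred_eq, hlast]
      refine le_dotProduct_of_mem_convexHull (fun v hv => ?_) hx
      rcases Finset.mem_union.1 hv with hv | hv <;>
        obtain ⟨n, -, rfl⟩ := Finset.mem_image.1 hv <;> simp
    · refine (forall_topNormals_iff (U := U)).2 ?_ n hn
      rcases Finset.mem_union.1 hv with hv | hv <;>
        obtain ⟨n, hn, rfl⟩ := Finset.mem_image.1 hv <;>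
        simp only [projInit_liftAt, lastCoord_liftAt]
      · exact ⟨by simpa using h.abs_dotProduct_le_one hn,
          fun v hv => by simpa using h.neg_one_le_dotProduct_rimPts hv hn⟩
      · refine ⟨by simp [dotProduct_eq_zero_of_mem_slicePts hn], fun v hv => ?_⟩
        linarith [neg_two_le_dotProduct_of_mem_slicePts hn
          fun n hn => h.neg_one_le_dotProduct_rimPts hv hn]
  · rintro x ⟨hx0, hx⟩
    obtain ⟨hxp, hxv⟩ := forall_topNormals_iff.1 ((hmem x).1 hx)
    by_contra hxT
    obtain ⟨f, hf⟩ := exists_separating_dotProduct hxT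
    set y := projInit f
    set t := lastCoord f
    set m := projInit x
    set c := lastCoord x
    have hfx : f ⬝ᵥ x = m ⬝ᵥ y + t * c := by
      rw [dotProduct_eq_projInit_add, dotProduct_comm (projInit f)]
    have hfW : ∀ n ∈ W, f ⬝ᵥ x < n ⬝ᵥ y := fun n hn => by
      have := hf _ (Finset.mem_union_left _ (Finset.mem_image_of_mem _ hn))
      rwa [dotProduct_comm f (liftAt _ _), liftAt_dotProduct, zero_mul, add_zero] at this
    have hfL : ∀ l ∈ slicePts W p, f ⬝ᵥ x < l ⬝ᵥ y + t := fun l hl => by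
      have := hf _ (Finset.mem_union_right _ (Finset.mem_image_of_mem _ hl))
      rwa [dotProduct_comm f (liftAt _ _), liftAt_dotProduct, one_mul] at this
    have hc0 : 0 ≤ c := hx0
    have hc1 : c ≤ 1 := by linarith [abs_nonneg (m ⬝ᵥ p)]
    obtain ⟨n, hn, hmin⟩ := W.exists_min_image (fun n => n ⬝ᵥ y)
      (by simpa using convexHull_nonempty_iff.1 ⟨_, h.zero_mem⟩)
    have ha0 : n ⬝ᵥ y ≤ 0 := by
      simpa using le_dotProduct_of_mem_convexHull (S := W) (y := y)
        (fun v hv => by simpa [dotProduct_comm y] using hmin v hv) h.zero_mem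
    rcases ha0.eq_or_lt with ha | ha
    · have hy : y = 0 := eq_zero_of_forall_nonneg h.mem_iff fun v hv => ha ▸ hmin v hv
      have h1 := hfW n hn
      have h2 := hfL 0 (zero_mem_slicePts W p)
      rw [hfx, hy, dotProduct_zero, dotProduct_zero] at h1
      rw [hfx, hy, dotProduct_zero, dotProduct_zero] at h2
      rcases le_total t 0 with ht | ht <;> nlinarith
    obtain ⟨a, haa⟩ : ∃ a, n ⬝ᵥ y = -a := ⟨-(n ⬝ᵥ y), by ring⟩
    simp only [haa] at hmin ha
    have hapos : 0 < a := by linarith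
    obtain ⟨γ, σ, w, hγ0, hσ, hyw, -, hbound, l, hl, hly⟩ :=
      h.exists_splitting_bound (y := a⁻¹ • y) fun v hv => by
        rw [dotProduct_smul, smul_eq_mul, inv_mul_eq_div, le_div_iff₀ hapos]
        linarith [hmin v hv]
    have hya : y = a • (w + σ • p) := by rw [← hyw, smul_inv_smul₀ hapos.ne']
    have hly' : l ⬝ᵥ y = -2 * γ * a := by
      rw [dotProduct_smul, smul_eq_mul, inv_mul_eq_div, div_eq_iff hapos.ne'] at hly
      exact hly
    have hmy : m ⬝ᵥ y = a * (m ⬝ᵥ w + σ * (m ⬝ᵥ p)) := by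
      rw [hya]; simp only [dotProduct_add, dotProduct_smul, smul_eq_mul]
    have h1 := hfW n hn
    have h2 := hfL l hl
    have hw := hbound m _ hxv
    have hσp : -((1 - γ) * (1 - c)) ≤ σ * (m ⬝ᵥ p) := by
      refine le_trans (neg_le_neg ?_) (neg_abs_le _)
      rw [abs_mul]
      exact mul_le_mul hσ hxp (abs_nonneg _) (by linarith [abs_nonneg σ])
    have hlow : a * (-((1 - γ) * (1 - c)) + γ * (-1 - c)) ≤ m ⬝ᵥ y := by
      rw [hmy]
      exact mul_le_mul_of_nonneg_left (by linarith) hapos.le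
    rw [hfx, haa] at h1
    rw [hfx, hly'] at h2
    have e1 := mul_le_mul_of_nonneg_left h1.le (sub_nonneg.2 hc1)
    have e2 := mul_le_mul_of_nonneg_left h2.le hc0
    rcases hc0.eq_or_lt with hc | hc
    · rw [← hc] at h1 hlow; nlinarith
    · have e3 := mul_lt_mul_of_pos_left h2 hc; nlinarith

lemma projInit_image_convexHull_topVertices (h : IsOppositePair U W p) :
    projInit '' (convexHull ℝ (topVertices W p : Set (Fin (k + 1) → ℝ)) ∩ {x | lastCoord x = 0}) =
      polarDual (convexHull ℝ (U : Set (Fin k → ℝ))) := by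
  ext m
  constructor
  · rintro ⟨x, ⟨hx, hx0 : lastCoord x = 0⟩, rfl⟩
    rw [h.convexHull_topVertices] at hx
    obtain ⟨hp, hv⟩ := forall_topNormals_iff.1 (Set.mem_iInter₂.1 hx.2)
    rw [hx0, sub_zero] at hp hv
    refine mem_polarDual.2 fun y hy => ?_
    obtain ⟨γ, σ, w, hγ0, hσ, rfl, -, hbound, -⟩ := h.exists_splitting_bound ((h.mem_iff y).1 hy)
    have hw := hbound _ _ hv
    have hσp : -(1 - γ) ≤ σ * (projInit x ⬝ᵥ p) := by
      refine le_trans (neg_le_neg ?_) (neg_abs_le _)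
      rw [abs_mul]
      exact (mul_le_of_le_one_right (abs_nonneg _) hp).trans hσ
    rw [dotProduct_comm, dotProduct_add, dotProduct_smul, smul_eq_mul]
    linarith
  · intro hm
    refine ⟨liftAt m 0, ⟨?_, lastCoord_liftAt m 0⟩, projInit_liftAt m 0⟩
    have hp : ∀ σ : ℝ, |σ| ≤ 1 → -1 ≤ (σ • p) ⬝ᵥ m := fun σ hσ =>
      mem_polarDual.1 hm _ ((h.mem_iff _).2 fun n hn => by
        rw [dotProduct_smul, smul_eq_mul]
        refine le_trans (neg_le_neg ?_) (neg_abs_le _)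
        rw [abs_mul]
        exact mul_le_one₀ hσ (abs_nonneg _) (h.abs_dotProduct_le_one hn))
    rw [h.convexHull_topVertices]
    refine ⟨(lastCoord_liftAt m 0).ge, Set.mem_iInter₂.2 (forall_topNormals_iff.2 ⟨?_, ?_⟩)⟩
    · have h1 := hp 1 (by simp)
      have h2 := hp (-1) (by simp)
      rw [smul_dotProduct, smul_eq_mul, dotProduct_comm] at h1 h2
      rw [projInit_liftAt, lastCoord_liftAt, abs_le]
      constructor <;> linarith
    · intro v hv
      rw [projInit_liftAt, lastCoord_liftAt, sub_zero, dotProduct_comm]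
      exact mem_polarDual.1 hm v (subset_convexHull ℝ _ (Finset.mem_filter.1 hv).1)

lemma isLatticePt_of_mem_topNormals (h : IsOppositePair U W p) {n : Fin (k + 1) → ℝ}
    (hn : n ∈ topNormals U W p) : IsLatticePt n := by
  simp only [topNormals, Finset.mem_union, Finset.mem_insert, Finset.mem_singleton,
    Finset.mem_image] at hn
  rcases hn with (rfl | rfl) | ⟨v, hv, rfl⟩
  · exact h.lattice_point.liftAt ⟨-1, by simp⟩
  · exact h.lattice_point.neg.liftAt ⟨-1, by simp⟩
  · exact (h.lattice_left v (Finset.mem_filter.1 hv).1).liftAt ⟨1, by simp⟩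

lemma isLatticePt_of_mem_topVertices (h : IsOppositePair U W p) {v : Fin (k + 1) → ℝ}
    (hv : v ∈ topVertices W p) : IsLatticePt v := by
  rcases Finset.mem_union.1 hv with hv | hv <;> obtain ⟨n, hn, rfl⟩ := Finset.mem_image.1 hv
  · exact (h.lattice_right n hn).liftAt ⟨0, by simp⟩
  · refine IsLatticePt.liftAt ?_ ⟨1, by simp⟩
    rcases mem_slicePts hn with rfl | ⟨a, ha, b, hb, -, rfl⟩
    · exact fun _ => ⟨0, by simp⟩
    · exact (h.lattice_right a ha).add (h.lattice_right b hb)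

lemma isShortTop (h : IsOppositePair U W p)
    (hU : IsReflexive (polarDual (convexHull ℝ (U : Set (Fin k → ℝ))))) :
    IsShortTop (convexHull ℝ (topVertices W p : Set (Fin (k + 1) → ℝ))) := by
  have heq := h.convexHull_topVertices
  refine ⟨⟨⟨_, fun v hv => h.isLatticePt_of_mem_topVertices hv, rfl⟩, fun x hx => ?_,
    ⟨_, fun n hn => h.isLatticePt_of_mem_topNormals hn, heq⟩, ?_⟩, ?_⟩
  · rw [heq] at hx
    exact hx.1
  · rwa [h.projInit_image_convexHull_topVertices]
  · rintro x ⟨⟨hx, hx1 : 1 ≤ lastCoord x⟩, -⟩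
    rw [heq] at hx
    obtain ⟨hp, -⟩ := forall_topNormals_iff.1 (Set.mem_iInter₂.1 hx.2)
    linarith [abs_nonneg (projInit x ⬝ᵥ p)]

/-- The bottom of the dual of the top is the segment from `(-p, -1)` to `(p, -1)`. -/
lemma polarDual_topVertices_bottom (h : IsOppositePair U W p) :
    {x ∈ polarDual (convexHull ℝ (topVertices W p : Set (Fin (k + 1) → ℝ))) |
      liftAt 0 1 ⬝ᵥ x = -1} = {x | ∃ σ : ℝ, |σ| ≤ 1 ∧ x = liftAt 0 (-1) + σ • liftAt p 0} := by
  have hlift : ∀ σ : ℝ, liftAt 0 (-1) + σ • liftAt p 0 = liftAt (σ • p) (-1) := fun σ => by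
    ext i
    refine Fin.lastCases ?_ (fun i => ?_) i <;> simp [liftAt]
  ext x
  simp only [Set.mem_ofPred_eq, mem_polarDual_convexHull, Finset.mem_coe, forall_topVertices_iff,
    liftAt_dotProduct, zero_dotProduct, zero_add, one_mul, hlift]
  constructor
  · rintro ⟨⟨hW, hL⟩, hx⟩
    obtain ⟨γ, σ, w, hγ0, hσ, hxw, hw, -, l, hl, hlx⟩ := h.exists_splitting_bound hW
    have hγ : γ = 0 := by
      have := hL l hl
      rw [hlx, hx] at this
      linarith
    refine ⟨σ, by simpa [hγ] using hσ, ?_⟩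
    rw [← liftAt_projInit_lastCoord x, hx, hxw, hw hγ, zero_add]
  · rintro ⟨σ, hσ, rfl⟩
    simp only [projInit_liftAt, lastCoord_liftAt, dotProduct_smul, smul_eq_mul]
    refine ⟨⟨fun n hn => le_trans (neg_le_neg ?_) (neg_abs_le _), fun l hl => ?_⟩, trivial⟩
    · rw [abs_mul]
      exact mul_le_one₀ hσ (abs_nonneg _) (h.abs_dotProduct_le_one hn)
    · rw [dotProduct_eq_zero_of_mem_slicePts hl]
      norm_num

end IsOppositePair

/-! ### Segments given by a midpoint and a half-length vector -/

lemma direction_affineSpan_centered_segment {k : ℕ} (a v : Fin k → ℝ) :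
    (affineSpan ℝ {x | ∃ σ : ℝ, |σ| ≤ 1 ∧ x = a + σ • v}).direction = Submodule.span ℝ {v} := by
  rw [direction_affineSpan]
  refine le_antisymm (Submodule.span_le.2 ?_) ?_
  · rintro _ ⟨_, ⟨σ, -, rfl⟩, _, ⟨τ, -, rfl⟩, rfl⟩
    exact Submodule.mem_span_singleton.2 ⟨σ - τ, by simp [sub_smul]⟩
  · rw [Submodule.span_singleton_le_iff_mem]
    have := vsub_mem_vectorSpan ℝ (s := {x | ∃ σ : ℝ, |σ| ≤ 1 ∧ x = a + σ • v})
      (p₁ := a + v) (p₂ := a) ⟨1, by simp⟩ ⟨0, by simp⟩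
    simpa using this

lemma mem_intrinsicInterior_centered_segment {k : ℕ} (a : Fin k → ℝ) {v : Fin k → ℝ}
    (hv : v ≠ 0) : a ∈ intrinsicInterior ℝ {x | ∃ σ : ℝ, |σ| ≤ 1 ∧ x = a + σ • v} := by
  set F := {x | ∃ σ : ℝ, |σ| ≤ 1 ∧ x = a + σ • v}
  have ha : a ∈ affineSpan ℝ F := subset_affineSpan ℝ _ ⟨0, by simp⟩
  have hvv : v ⬝ᵥ v ≠ 0 := fun h => hv (dotProduct_self_eq_zero.1 h)
  have hopen : IsOpen {x : affineSpan ℝ F | |v ⬝ᵥ ((x : Fin k → ℝ) - a) / (v ⬝ᵥ v)| < 1} :=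
    isOpen_lt (((continuous_const.dotProduct
      (continuous_subtype_val.sub continuous_const)).div_const _).abs) continuous_const
  refine mem_intrinsicInterior.2 ⟨⟨a, ha⟩, interior_maximal (fun x hx => ?_) hopen ?_, rfl⟩
  · have hmem := AffineSubspace.vsub_mem_direction x.2 ha
    rw [direction_affineSpan_centered_segment] at hmem
    obtain ⟨σ, hσ⟩ := Submodule.mem_span_singleton.1 hmem
    rw [vsub_eq_sub] at hσ
    rw [Set.mem_ofPred_eq, ← hσ, dotProduct_smul, smul_eq_mul, mul_div_cancel_right₀ _ hvv] at hx
    exact ⟨σ, hx.le, by rw [hσ]; simp⟩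
  · simp

lemma negE_eq_liftAt (k : ℕ) : negE k = liftAt 0 (-1) := by
  ext i
  refine Fin.lastCases ?_ (fun i => ?_) i <;> simp [negE, liftAt]

lemma IsOppositePair.exists_edge {k : ℕ} {U W : Finset (Fin k → ℝ)} {p : Fin k → ℝ}
    (h : IsOppositePair U W p) (hp : p ≠ 0) :
    ∃ F, IsFace (polarDual (convexHull ℝ (topVertices W p : Set (Fin (k + 1) → ℝ)))) F 1 ∧
      negE k ∈ intrinsicInterior ℝ F := by
  have hp' : liftAt p 0 ≠ 0 := fun h0 => hp <| by
    rw [← projInit_liftAt p 0, h0]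
    rfl
  refine ⟨_, ⟨liftAt 0 1, -1, fun h0 => ?_, fun x hx => ?_, h.polarDual_topVertices_bottom.symm,
    ?_⟩, ?_⟩
  · have := lastCoord_liftAt (0 : Fin k → ℝ) 1
    rw [h0] at this
    exact zero_ne_one this
  · exact mem_polarDual.1 hx _ (subset_convexHull ℝ _ (Finset.mem_coe.2 (Finset.mem_union_right _
      (Finset.mem_image_of_mem _ (zero_mem_slicePts W p)))))
  · rw [direction_affineSpan_centered_segment, finrank_span_singleton hp']
  · rw [negE_eq_liftAt]
    exact mem_intrinsicInterior_centered_segment _ hp'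

/-- If a three-dimensional reflexive polytope `Δ°` admits a lattice point
triangulation in which every 3-simplex contains a fixed segment between two boundary
lattice points with the origin in its interior, then there is a four-dimensional short
top with reflexive boundary `(Δ°)°` whose polar dual has `(0,0,0,-1)` in the interior of
an edge. -/
theorem stmt14 (D : Set (Fin 3 → ℝ)) (hD : IsReflexive D)
    (𝒯 : Finset (Finset (Fin 3 → ℝ))) (h𝒯 : IsSolidLatticeTriangulation D 𝒯)
    (p q : Fin 3 → ℝ) (hp : p ∈ latticePts (frontier D)) (hq : q ∈ latticePts (frontier D))
    (h0 : (0 : Fin 3 → ℝ) ∈ openSegment ℝ p q)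
    (he : ∀ σ ∈ 𝒯, segment ℝ p q ⊆ convexHull ℝ (σ : Set (Fin 3 → ℝ))) :
    ∃ T : Set (Fin (3+1) → ℝ), IsShortTop T ∧
      projInit '' (T ∩ {x | lastCoord x = 0}) = polarDual D ∧
      ∃ F, IsFace (polarDual T) F 1 ∧ negE 3 ∈ intrinsicInterior ℝ F := by
  obtain ⟨⟨U, hU, rfl⟩, hD0, ⟨W, hW, hDW⟩⟩ := hD
  have hbi := polarDual_polarDual hD0
  have hzero : (0 : Fin 3 → ℝ) ∈ polarDual (convexHull ℝ (U : Set (Fin 3 → ℝ))) :=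
    mem_polarDual.2 fun x _ => by rw [dotProduct_zero]; norm_num
  have hmem : ∀ x, x ∈ convexHull ℝ (U : Set (Fin 3 → ℝ)) ↔ ∀ n ∈ W, -1 ≤ n ⬝ᵥ x := fun x => by
    rw [← hbi, hDW, mem_polarDual_convexHull]
    rfl
  have hsub : frontier (convexHull ℝ (U : Set (Fin 3 → ℝ))) ⊆ convexHull ℝ (U : Set _) :=
    (U.finite_toSet.isClosed_convexHull ℝ).frontier_subset
  obtain rfl := eq_neg_of_zero_mem_openSegment hmem hW (hsub hp.1) (hsub hq.1) hp hq h0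
  obtain ⟨n, -, hn⟩ := exists_dotProduct_eq_neg_one_of_mem_frontier hmem (hsub hp.1) hp.1
  have hp0 : p ≠ 0 := by
    rintro rfl
    rw [dotProduct_zero] at hn
    norm_num at hn
  have hpair : IsOppositePair U W p := ⟨hU, hW, hp.2, hDW ▸ hzero, hmem, fun n hn => by
    obtain ⟨i, hi⟩ := (hW n hn).dotProduct hp.2
    have h1 := (hmem _).1 (hsub hp.1) n hn
    have h2 := (hmem _).1 (hsub hq.1) n hn
    rw [dotProduct_neg] at h2
    rw [hi] at h1 h2 ⊢
    have h1' : -1 ≤ i := by exact_mod_cast h1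
    have h2' : -1 ≤ -i := by exact_mod_cast h2
    have : i = -1 ∨ i = 0 ∨ i = 1 := by omega
    exact_mod_cast this⟩
  refine ⟨_, hpair.isShortTop ⟨⟨W, hW, hDW⟩, hzero, ?_⟩,
    hpair.projInit_image_convexHull_topVertices, hpair.exists_edge hp0⟩
  rw [hbi]
  exact ⟨U, hU, rfl⟩

end SemistableTops
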